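/- Let D_f, D_{f_1},…,D_{f_m} be finite divergences and let D_{f_{m+1}},…,D_{f_{m+l}} be non-finite divergences (all arising from convex functions with value 0 at 1). Then for all D_1,…,D_{m+l} ≥ 0, B(D_1,…,D_{m+l}) = B(D_1,…,D_m); that is, the infimum of D_f(P‖Q) subject to D_{f_i}(P‖Q) ≥ D_i for i = 1,…,m+l equals the infimum of D_f(P‖Q) subject only to D_{f_i}(P‖Q) ≥ D_i for i = 1,…,m, both infima being over all pairs of probability measures on all measurable spaces. -/

import Mathlib

open MeasureTheory Filter Set
open scoped ENNReal NNReal Classical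

noncomputable section

/-- The limit of `f` at `0` from the right, as an extended real number
(for `f` convex on `(0,∞)` the `limsup` below is the actual limit). -/
def limAtZero (f : ℝ → ℝ) : EReal :=
  Filter.limsup (fun x => (f x : EReal)) (nhdsWithin 0 (Set.Ioi 0))

/-- The limit of `f x / x` as `x → ∞`, as an extended real number
(for `f` convex on `(0,∞)` the `limsup` below is the actual limit). -/
def derivAtTop (f : ℝ → ℝ) : EReal :=
  Filter.limsup (fun x => ((f x / x : ℝ) : EReal)) Filter.atTop

/-- The `f`-divergence `D_f(P‖Q) = ∫_{q>0} f(p/q) dQ + f'(∞) P{q = 0}`, where the part of the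
integral over `{p = 0, q > 0}` is interpreted via the limit `f(0) := lim_{x↓0} f x`, and the part
over `{q = 0}` (the `Q`-singular part of `P`) via `f'(∞) := lim_{x→∞} f x / x`. -/
def fDiv (f : ℝ → ℝ) {Ω : Type*} [MeasurableSpace Ω] (P Q : Measure Ω) : EReal :=
  (if Integrable (fun x => f ((Measure.rnDeriv P Q x).toReal))
      (Q.restrict {x | Measure.rnDeriv P Q x ≠ 0})
   then ((∫ x in {x | Measure.rnDeriv P Q x ≠ 0},
       f ((Measure.rnDeriv P Q x).toReal) ∂Q : ℝ) : EReal)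
   else (⊤ : EReal))
  + limAtZero f * ((Q {x | Measure.rnDeriv P Q x = 0} : ℝ≥0∞) : EReal)
  + derivAtTop f * ((Measure.singularPart P Q Set.univ : ℝ≥0∞) : EReal)

/-- A pair of probability measures on an arbitrary measurable space. -/
structure PMPair where
  carrier : Type
  inst : MeasurableSpace carrier
  P : @Measure carrier inst
  Q : @Measure carrier inst
  probP : @IsProbabilityMeasure carrier inst P
  probQ : @IsProbabilityMeasure carrier inst Q

attribute [instance] PMPair.inst

/-- The total variation distance `V(P,Q) = (1/2) ∫ |p - q| dλ` (with `λ = P + Q`). -/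
def tvDist {Ω : Type*} [MeasurableSpace Ω] (P Q : Measure Ω) : ℝ :=
  (∫ x, |(Measure.rnDeriv P (P + Q) x).toReal - (Measure.rnDeriv Q (P + Q) x).toReal|
    ∂(P + Q)) / 2

/-- The function `ψ_{P,Q}(s) = ∫ min (p, q s) dλ` (with `λ = P + Q`). -/
def psiPQ {Ω : Type*} [MeasurableSpace Ω] (P Q : Measure Ω) (s : ℝ) : ℝ :=
  ∫ x, min ((Measure.rnDeriv P (P + Q) x).toReal)
    ((Measure.rnDeriv Q (P + Q) x).toReal * s) ∂(P + Q)

/-- The right derivative of `f`. -/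
def rightDeriv (f : ℝ → ℝ) (x : ℝ) : ℝ := derivWithin f (Set.Ioi x) x

/-- `ν` is the measure `ν_f` on `(0,∞)` with `ν (a,b] = ∂⁺f(b) - ∂⁺f(a)`. -/
def IsCurvatureMeasure (f : ℝ → ℝ) (ν : Measure ℝ) : Prop :=
  ∀ a b : ℝ, 0 < a → a ≤ b →
    ν (Set.Ioc a b) = ENNReal.ofReal (rightDeriv f b - rightDeriv f a)

/-- The functional `I_f(ψ) = ∫_{(0,∞)} (min(1,s) - ψ(s)) dν_f(s)`. -/
def Ifun (ν : Measure ℝ) (ψ : ℝ → ℝ) : ℝ≥0∞ :=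
  ∫⁻ s in Set.Ioi (0 : ℝ), ENNReal.ofReal (min 1 s - ψ s) ∂ν

/-- The class `C` of functions on `[0,∞)` (encoded as functions on `ℝ` vanishing on `(-∞,0)`)
that are nonnegative, concave, nondecreasing and bounded by `min(1,s)` on `[0,∞)`. -/
def Cclass : Set (ℝ → ℝ) :=
  {ψ | (∀ s, 0 ≤ s → 0 ≤ ψ s) ∧ ConcaveOn ℝ (Set.Ici 0) ψ ∧ MonotoneOn ψ (Set.Ici 0) ∧
    (∀ s, 0 ≤ s → ψ s ≤ min 1 s) ∧ ∀ s, s < 0 → ψ s = 0}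

lemma aux_lower {f : ℝ → ℝ} (hf : ConvexOn ℝ (Set.Ioi 0) f) (hf1 : f 1 = 0) :
    ∃ C : ℝ, 0 ≤ C ∧ ∀ x, 0 < x → -(C * (1 + x)) ≤ f x := by
  refine ⟨2 * |f (1/2)| + |f 2|, by positivity, fun x hx => ?_⟩
  have h1 := neg_abs_le (f (1/2))
  have h1' := le_abs_self (f (1/2))
  have h2 := neg_abs_le (f 2)
  have h2' := le_abs_self (f 2)
  have p1 := abs_nonneg (f (1/2))
  have p2 := abs_nonneg (f 2)
  rcases lt_trichotomy x 1 with h | h | h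
  · have := hf.slope_mono_adjacent (x := x) (y := 1) (z := 2) hx (by norm_num [Set.mem_Ioi]) h
      (by norm_num)
    rw [div_le_div_iff₀ (by linarith) (by norm_num)] at this
    rw [hf1] at this
    have : -f x ≤ |f 2| * (1 - x) := by nlinarith
    nlinarith
  · subst h; rw [hf1]; nlinarith
  · have := hf.slope_mono_adjacent (x := 1/2) (y := 1) (z := x) (by norm_num [Set.mem_Ioi]) hx
      (by norm_num) h
    rw [div_le_div_iff₀ (by norm_num) (by linarith)] at this
    rw [hf1] at this
    have : -f x ≤ 2 * |f (1/2)| * (x - 1) := by nlinarith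
    nlinarith

lemma limAtZero_ne_bot {f : ℝ → ℝ} (hf : ConvexOn ℝ (Set.Ioi 0) f) (hf1 : f 1 = 0) :
    limAtZero f ≠ ⊥ := by
  obtain ⟨C, hC, h⟩ := aux_lower hf hf1
  have : ((-(C * 2) : ℝ) : EReal) ≤ limAtZero f := by
    refine le_trans ?_ (Filter.liminf_le_limsup)
    refine Filter.le_liminf_of_le (by isBoundedDefault) ?_
    have : Set.Ioo (0:ℝ) 1 ∈ nhdsWithin (0:ℝ) (Set.Ioi 0) := Ioo_mem_nhdsGT one_pos
    filter_upwards [this] with x hx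
    have := h x hx.1
    have h2 := hx.2
    exact_mod_cast (by nlinarith : -(C*2) ≤ f x)
  intro h0
  rw [h0, le_bot_iff] at this
  exact EReal.coe_ne_bot _ this

lemma derivAtTop_ne_bot {f : ℝ → ℝ} (hf : ConvexOn ℝ (Set.Ioi 0) f) (hf1 : f 1 = 0) :
    derivAtTop f ≠ ⊥ := by
  obtain ⟨C, hC, h⟩ := aux_lower hf hf1
  have : ((-(C * 2) : ℝ) : EReal) ≤ derivAtTop f := by
    refine le_trans ?_ (Filter.liminf_le_limsup)
    refine Filter.le_liminf_of_le (by isBoundedDefault) ?_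
    filter_upwards [Filter.eventually_ge_atTop (1:ℝ)] with x hx
    have := h x (by linarith)
    have : -(C*2) ≤ f x / x := by
      rw [le_div_iff₀ (by linarith)]
      nlinarith
    exact_mod_cast this
  intro h0
  rw [h0, le_bot_iff] at this
  exact EReal.coe_ne_bot _ this

lemma aux_upper {f : ℝ → ℝ} (hf : ConvexOn ℝ (Set.Ioi 0) f) {L M : ℝ}
    (hL : limAtZero f = L) (hM : derivAtTop f = M) (x : ℝ) (hx : 0 < x) :
    f x ≤ L + M * x := by
  have key : ∀ δ > 0, f x ≤ (L + δ) + (M + δ) * x := by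
    intro δ hδ
    have e1 : ∀ᶠ a in nhdsWithin (0:ℝ) (Set.Ioi 0), f a < L + δ := by
      have : Filter.limsup (fun x => (f x : EReal)) (nhdsWithin 0 (Set.Ioi 0))
          < ((L + δ : ℝ) : EReal) := by
        change limAtZero f < _
        rw [hL]; exact_mod_cast (by linarith)
      filter_upwards [Filter.eventually_lt_of_limsup_lt this] with a ha
      exact_mod_cast ha
    have e2 : ∀ᶠ b in (Filter.atTop : Filter ℝ), f b / b < M + δ := by
      have : Filter.limsup (fun x => ((f x / x : ℝ) : EReal)) Filter.atTop
          < ((M + δ : ℝ) : EReal) := by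
        change derivAtTop f < _
        rw [hM]; exact_mod_cast (by linarith)
      filter_upwards [Filter.eventually_lt_of_limsup_lt this] with a ha
      exact_mod_cast ha
    have s1 : ∀ᶠ b in (Filter.atTop : Filter ℝ),
        f x ≤ (1 - x / b) * (L + δ) + x * (M + δ) := by
      filter_upwards [e2, Filter.eventually_gt_atTop x] with b hb hxb
      have hb0 : 0 < b := hx.trans hxb
      rw [div_lt_iff₀ hb0] at hb
      have s2 : ∀ᶠ a in nhdsWithin (0:ℝ) (Set.Ioi 0),
          f x ≤ (b - x) / (b - a) * (L + δ) + (x - a) / (b - a) * ((M + δ) * b) := by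
        have : Set.Ioo (0:ℝ) x ∈ nhdsWithin (0:ℝ) (Set.Ioi 0) := Ioo_mem_nhdsGT hx
        filter_upwards [e1, this] with a ha hax
        obtain ⟨ha0, hax⟩ := hax
        have hba : 0 < b - a := by linarith
        have w1 : 0 ≤ (b - x) / (b - a) := div_nonneg (by linarith) hba.le
        have w2 : 0 ≤ (x - a) / (b - a) := div_nonneg (by linarith) hba.le
        have := hf.2 (x := a) (y := b) ha0 hb0 w1 w2 (by field_simp; ring)
        simp only [smul_eq_mul] at this
        have hxe : (b - x) / (b - a) * a + (x - a) / (b - a) * b = x := by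
          field_simp; ring
        rw [hxe] at this
        refine this.trans ?_
        gcongr
      have T : Filter.Tendsto (fun a : ℝ =>
          (b - x) / (b - a) * (L + δ) + (x - a) / (b - a) * ((M + δ) * b))
          (nhdsWithin (0:ℝ) (Set.Ioi 0))
          (nhds ((b - x) / (b - 0) * (L + δ) + (x - 0) / (b - 0) * ((M + δ) * b))) := by
        apply Filter.Tendsto.mono_left _ nhdsWithin_le_nhds
        apply ContinuousAt.tendsto
        have : b - 0 ≠ 0 := by simpa using hb0.ne'
        fun_prop (disch := assumption)
      have := ge_of_tendsto T s2
      refine this.trans_eq ?_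
      rw [sub_zero, sub_zero]
      have hbn : b ≠ 0 := hb0.ne'
      field_simp
    have T : Filter.Tendsto (fun b : ℝ => (1 - x / b) * (L + δ) + x * (M + δ)) Filter.atTop
        (nhds ((1 - 0) * (L + δ) + x * (M + δ))) := by
      have : Filter.Tendsto (fun b : ℝ => x / b) Filter.atTop (nhds 0) :=
        tendsto_const_nhds.div_atTop Filter.tendsto_id
      exact ((tendsto_const_nhds.sub this).mul_const _).add_const _
    have := ge_of_tendsto T s1
    linarith
  by_contra hc
  push Not at hc
  have hp : 0 < f x - (L + M * x) := by linarith
  have := key ((f x - (L + M * x)) / (2 * (1 + x))) (by positivity)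
  have e : (f x - (L + M * x)) / (2 * (1 + x)) * (1 + x) = (f x - (L + M * x)) / 2 := by
    field_simp
  nlinarith

lemma mul_ne_bot' {L : EReal} (hL : L ≠ ⊥) {q : ℝ≥0∞} (hq : q ≠ ⊤) : L * (q : EReal) ≠ ⊥ := by
  lift q to ℝ≥0 using hq
  have : ((q : ℝ≥0∞) : EReal) = ((q : ℝ) : EReal) := rfl
  rw [this]
  induction L with
  | bot => exact absurd rfl hL
  | coe r => rw [← EReal.coe_mul]; exact EReal.coe_ne_bot _
  | top =>
    rcases eq_or_ne q 0 with h | h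
    · simp [h]
    · rw [EReal.top_mul_coe_of_pos (by positivity)]; simp

lemma fDiv_ne_bot {f : ℝ → ℝ} (hf : ConvexOn ℝ (Set.Ioi 0) f) (hf1 : f 1 = 0)
    {Ω : Type*} [MeasurableSpace Ω] (P Q : Measure Ω) [IsProbabilityMeasure P]
    [IsProbabilityMeasure Q] : fDiv f P Q ≠ ⊥ := by
  unfold fDiv
  rw [EReal.add_ne_bot_iff, EReal.add_ne_bot_iff]
  refine ⟨⟨?_, mul_ne_bot' (limAtZero_ne_bot hf hf1) (measure_ne_top _ _)⟩,
    mul_ne_bot' (derivAtTop_ne_bot hf hf1) (measure_ne_top _ _)⟩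
  split_ifs
  · exact EReal.coe_ne_bot _
  · simp

lemma fDiv_le {f : ℝ → ℝ} (hf : ConvexOn ℝ (Set.Ioi 0) f) (hf1 : f 1 = 0)
    {Ω : Type*} [MeasurableSpace Ω] (P Q : Measure Ω) [IsProbabilityMeasure P]
    [IsProbabilityMeasure Q] : fDiv f P Q ≤ limAtZero f + derivAtTop f := by
  have hL := limAtZero_ne_bot hf hf1
  have hM := derivAtTop_ne_bot hf hf1
  by_cases hLt : limAtZero f = ⊤
  · rw [hLt, EReal.top_add_of_ne_bot hM]; exact le_top
  by_cases hMt : derivAtTop f = ⊤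
  · rw [hMt, EReal.add_top_of_ne_bot hL]; exact le_top
  obtain ⟨L, hL⟩ : ∃ L : ℝ, limAtZero f = L := ⟨_, (EReal.coe_toReal hLt hL).symm⟩
  obtain ⟨M, hM⟩ : ∃ M : ℝ, derivAtTop f = M := ⟨_, (EReal.coe_toReal hMt hM).symm⟩
  obtain ⟨C, hC, hlow⟩ := aux_lower hf hf1
  have hup := aux_upper hf hL hM
  set g := P.rnDeriv Q with hg
  have hgm : Measurable g := Measure.measurable_rnDeriv _ _
  have hS : MeasurableSet {x | g x ≠ 0} := hgm (measurableSet_singleton 0).compl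
  have hpos : ∀ᵐ x ∂(Q.restrict {x | g x ≠ 0}), 0 < (g x).toReal := by
    rw [ae_restrict_iff' hS]
    filter_upwards [Measure.rnDeriv_ne_top P Q] with x hx h0
    exact ENNReal.toReal_pos h0 hx
  have hgi : Integrable (fun x => (g x).toReal) (Q.restrict {x | g x ≠ 0}) :=
    Measure.integrable_toReal_rnDeriv.restrict
  have hfm : AEStronglyMeasurable (fun x => f (g x).toReal) (Q.restrict {x | g x ≠ 0}) := by
    have hc : ContinuousOn f (Set.Ioi 0) := hf.continuousOn isOpen_Ioi
    have hfi : Measurable ((Set.Ioi (0:ℝ)).indicator f) := by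
      have := hc.measurable_piecewise (g := fun _ => (0:ℝ)) continuousOn_const measurableSet_Ioi
      rwa [← Set.piecewise_eq_indicator]
    refine ⟨fun x => (Set.Ioi (0:ℝ)).indicator f (g x).toReal,
      (hfi.comp hgm.ennreal_toReal).stronglyMeasurable, ?_⟩
    filter_upwards [hpos] with x hx
    rw [Set.indicator_of_mem (Set.mem_Ioi.mpr hx)]
  have hint : Integrable (fun x => f (g x).toReal) (Q.restrict {x | g x ≠ 0}) := by
    refine Integrable.mono' (g := fun x => (C + |L|) + (C + |M|) * (g x).toReal)
      ((integrable_const _).add (hgi.const_mul _)) hfm ?_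
    filter_upwards [hpos] with x hx
    have h1 := hlow _ hx
    have h2 := hup _ hx
    have h3 := le_abs_self L
    have h4 := le_abs_self M
    have h5 := abs_nonneg L
    have h6 := abs_nonneg M
    rw [Real.norm_eq_abs, abs_le]
    constructor <;> nlinarith
  have hle : ∫ x in {x | g x ≠ 0}, f (g x).toReal ∂Q
      ≤ L * Q.real {x | g x ≠ 0} + M * ∫ x in {x | g x ≠ 0}, (g x).toReal ∂Q := by
    have : ∫ x in {x | g x ≠ 0}, (L + M * (g x).toReal) ∂Q
        = L * Q.real {x | g x ≠ 0} + M * ∫ x in {x | g x ≠ 0}, (g x).toReal ∂Q := by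
      rw [integral_add (integrable_const _) (hgi.const_mul _), integral_const_mul]
      simp [mul_comm]
    rw [← this]
    refine integral_mono_ae hint ((integrable_const _).add (hgi.const_mul _)) ?_
    filter_upwards [hpos] with x hx using hup _ hx
  have hgint : ∫ x in {x | g x ≠ 0}, (g x).toReal ∂Q = 1 - (P.singularPart Q).real univ := by
    have h1 : ∫ x in {x | g x ≠ 0}, (g x).toReal ∂Q = ∫ x, (g x).toReal ∂Q := by
      apply setIntegral_eq_integral_of_forall_compl_eq_zero
      intro x hx
      replace hx : g x = 0 := not_not.mp hx
      simp [hx]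
    rw [h1]
    have h2 := Measure.setIntegral_toReal_rnDeriv_eq_withDensity (μ := P) (ν := Q) Set.univ
    rw [setIntegral_univ] at h2
    rw [hg, h2]
    have h3 : P.real univ = (P.singularPart Q + Q.withDensity (P.rnDeriv Q)).real univ := by
      rw [Measure.singularPart_add_rnDeriv]
    rw [measureReal_add_apply] at h3
    simp only [probReal_univ] at h3
    linarith
  have hq : Q.real {x | g x ≠ 0} = 1 - Q.real {x | g x = 0} := by
    have := probReal_compl_eq_one_sub (μ := Q) (hgm (measurableSet_singleton 0))
    exact this
  unfold fDiv
  rw [if_pos hint, hL, hM]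
  have c1 : ((Q {x | g x = 0} : ℝ≥0∞) : EReal) = ((Q.real {x | g x = 0} : ℝ) : EReal) :=
    (EReal.coe_ennreal_toReal (measure_ne_top _ _)).symm
  have c2 : ((P.singularPart Q univ : ℝ≥0∞) : EReal) = (((P.singularPart Q).real univ : ℝ) : EReal) :=
    (EReal.coe_ennreal_toReal (measure_ne_top _ _)).symm
  rw [c1, c2]
  norm_cast
  rw [hgint, hq] at hle
  change _ + L * Q.real {x | g x = 0} + _ ≤ _
  nlinarith

lemma fDiv_of_decomp (f : ℝ → ℝ) {Ω : Type*} [MeasurableSpace Ω] (P Q s : Measure Ω)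
    [SigmaFinite Q] (g : Ω → ℝ≥0∞) (hg : Measurable g) (hs : s ⟂ₘ Q)
    (h : P = s + Q.withDensity g) :
    fDiv f P Q = (if Integrable (fun x => f (g x).toReal) (Q.restrict {x | g x ≠ 0})
      then ((∫ x in {x | g x ≠ 0}, f (g x).toReal ∂Q : ℝ) : EReal) else (⊤ : EReal))
      + limAtZero f * ((Q {x | g x = 0} : ℝ≥0∞) : EReal)
      + derivAtTop f * ((s Set.univ : ℝ≥0∞) : EReal) := by
  have e1 := Measure.eq_singularPart hg hs h
  have e2 := Measure.eq_rnDeriv hg hs h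
  have r : Q.restrict {x | P.rnDeriv Q x ≠ 0} = Q.restrict {x | g x ≠ 0} := by
    apply Measure.restrict_congr_set
    filter_upwards [e2] with x hx
    apply propext
    change P.rnDeriv Q x ≠ 0 ↔ g x ≠ 0
    rw [hx]
  have r2 : Q {x | P.rnDeriv Q x = 0} = Q {x | g x = 0} := by
    apply measure_congr
    filter_upwards [e2] with x hx
    apply propext
    change P.rnDeriv Q x = 0 ↔ g x = 0
    rw [hx]
  have e3 : (fun x => f (P.rnDeriv Q x).toReal) =ᵐ[Q.restrict {x | g x ≠ 0}]
      (fun x => f (g x).toReal) := by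
    filter_upwards [ae_restrict_of_ae e2] with x hx
    rw [hx]
  unfold fDiv
  rw [← e1, r, r2, integral_congr_ae e3]
  simp only [integrable_congr e3]

/-- Mixture of `P` with a point mass at a new point. -/
def mixP {Ω : Type*} [MeasurableSpace Ω] (a e : ℝ≥0) (P : Measure Ω) (b : Bool) :
    Measure (Ω ⊕ Bool) :=
  (a : ℝ≥0∞) • P.map Sum.inl + (e : ℝ≥0∞) • Measure.dirac (Sum.inr b)

lemma mixP_prob {Ω : Type*} [MeasurableSpace Ω] {a e : ℝ≥0} (hae : a + e = 1)
    (P : Measure Ω) [IsProbabilityMeasure P] (b : Bool) : IsProbabilityMeasure (mixP a e P b) := by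
  constructor
  unfold mixP
  simp only [Measure.add_apply, Measure.smul_apply, smul_eq_mul,
    Measure.map_apply measurable_inl MeasurableSet.univ, Set.preimage_univ, measure_univ, mul_one]
  exact_mod_cast hae

lemma memb_inl {Ω : Type*} [MeasurableSpace Ω] :
    MeasurableEmbedding (Sum.inl : Ω → Ω ⊕ Bool) :=
  ⟨Sum.inl_injective, measurable_inl, fun _ hs => hs.inl_image⟩

lemma fDiv_mix (f : ℝ → ℝ) (hf : ConvexOn ℝ (Set.Ioi 0) f) (hf1 : f 1 = 0)
    {Ω : Type*} [MeasurableSpace Ω] (P Q : Measure Ω) [IsProbabilityMeasure P]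
    [IsProbabilityMeasure Q] (a e : ℝ≥0) (ha : 0 < a) (hae : a + e = 1) :
    fDiv f (mixP a e P true) (mixP a e Q false) =
      ((a : ℝ) : EReal) * fDiv f P Q + ((e : ℝ) : EReal) * (limAtZero f + derivAtTop f) := by
  have hL := limAtZero_ne_bot hf hf1
  have hM := derivAtTop_ne_bot hf hf1
  have := mixP_prob hae P true
  have := mixP_prob hae Q false
  set g := P.rnDeriv Q with hg
  have hgm : Measurable g := Measure.measurable_rnDeriv _ _
  set g' : Ω ⊕ Bool → ℝ≥0∞ := Sum.elim g (fun _ => 0) with hg'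
  have hgm' : Measurable g' := hgm.sumElim measurable_const
  have hsing : mixP a e (P.singularPart Q) true ⟂ₘ mixP a e Q false := by
    obtain ⟨S, hS, h1, h2⟩ := Measure.mutuallySingular_singularPart P Q
    refine ⟨Sum.inl '' S ∪ Sum.inr '' {false}, ?_, ?_, ?_⟩
    · exact hS.inl_image.union (MeasurableSet.inr_image (measurableSet_singleton _))
    · have hm : MeasurableSet (Sum.inl '' S ∪ Sum.inr '' {false} : Set (Ω ⊕ Bool)) :=
        hS.inl_image.union (MeasurableSet.inr_image (measurableSet_singleton _))
      unfold mixP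
      have : (Sum.inl ⁻¹' (Sum.inl '' S ∪ Sum.inr '' {false} : Set (Ω ⊕ Bool))) = S := by
        ext; simp
      simp only [Measure.add_apply, Measure.smul_apply, smul_eq_mul,
        Measure.map_apply measurable_inl hm, Measure.dirac_apply' _ hm, this, h1]
      simp
    · have hm : MeasurableSet (Sum.inl '' S ∪ Sum.inr '' {false} : Set (Ω ⊕ Bool))ᶜ :=
        (hS.inl_image.union (MeasurableSet.inr_image (measurableSet_singleton _))).compl
      unfold mixP
      have : (Sum.inl ⁻¹' (Sum.inl '' S ∪ Sum.inr '' {false} : Set (Ω ⊕ Bool))ᶜ) = Sᶜ := by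
        ext; simp
      simp only [Measure.add_apply, Measure.smul_apply, smul_eq_mul,
        Measure.map_apply measurable_inl hm, Measure.dirac_apply' _ hm, this, h2]
      simp
  have hdec : mixP a e P true = mixP a e (P.singularPart Q) true
      + (mixP a e Q false).withDensity g' := by
    have hwd : (mixP a e Q false).withDensity g' = (a : ℝ≥0∞) • (Q.withDensity g).map Sum.inl := by
      ext s hs
      rw [withDensity_apply _ hs]
      unfold mixP
      rw [Measure.restrict_add, lintegral_add_measure, Measure.restrict_smul,
        Measure.restrict_smul, lintegral_smul_measure, lintegral_smul_measure,
        setLIntegral_map hs hgm' measurable_inl, Measure.smul_apply,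
        Measure.map_apply measurable_inl hs, withDensity_apply _ (measurable_inl hs)]
      have : ∫⁻ x in s, g' x ∂(Measure.dirac (Sum.inr false)) = 0 := by
        rw [lintegral_eq_zero_iff hgm']
        apply ae_restrict_of_ae
        exact (ae_dirac_iff (p := fun x => g' x = 0) (hgm' (measurableSet_singleton 0))).mpr rfl
      rw [this]
      simp [hg']
    rw [hwd]
    unfold mixP
    conv_lhs => rw [← Measure.singularPart_add_rnDeriv P Q, Measure.map_add _ _ measurable_inl,
      smul_add]
    rw [add_right_comm]
  rw [fDiv_of_decomp f _ _ _ g' hgm' hsing hdec]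
  have hres : (mixP a e Q false).restrict {x | g' x ≠ 0}
      = (a : ℝ≥0∞) • (Q.restrict {x | g x ≠ 0}).map Sum.inl := by
    have hm' : MeasurableSet {x | g' x ≠ 0} := hgm' (measurableSet_singleton 0).compl
    unfold mixP
    rw [Measure.restrict_add, Measure.restrict_smul, Measure.restrict_smul,
      Measure.restrict_map measurable_inl hm']
    have : (Measure.dirac (Sum.inr false : Ω ⊕ Bool)).restrict {x | g' x ≠ 0} = 0 := by
      rw [Measure.restrict_eq_zero, Measure.dirac_apply' _ hm']
      simp [hg']
    rw [this]
    simp [hg', Set.preimage]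
  have hq : mixP a e Q false {x | g' x = 0} = a * Q {x | g x = 0} + e := by
    have hm' : MeasurableSet {x | g' x = 0} := hgm' (measurableSet_singleton 0)
    unfold mixP
    simp only [Measure.add_apply, Measure.smul_apply, smul_eq_mul,
        Measure.map_apply measurable_inl hm', Measure.dirac_apply' _ hm']
    rw [Set.indicator_of_mem (show (Sum.inr false : Ω ⊕ Bool) ∈ {x | g' x = 0} from rfl)]
    simp [hg', Set.preimage]
  have hsu : mixP a e (P.singularPart Q) true univ = a * P.singularPart Q univ + e := by
    unfold mixP
    simp only [Measure.add_apply, Measure.smul_apply, smul_eq_mul,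
        Measure.map_apply measurable_inl MeasurableSet.univ]
    simp
  rw [hres, hq, hsu, integrable_smul_measure (by exact_mod_cast ha.ne') (by simp),
    memb_inl.integrable_map_iff, integral_smul_measure, memb_inl.integral_map]
  have hcomp : ((fun x => f (g' x).toReal) ∘ Sum.inl) = fun x => f (g x).toReal := by
    ext x; simp [hg']
  rw [hcomp]
  unfold fDiv
  have haR : (0:ℝ) < a := ha
  have e1 : (if Integrable (fun x => f (g x).toReal) (Q.restrict {x | g x ≠ 0}) then
      (((a : ℝ≥0∞).toReal • ∫ x in {x | g x ≠ 0}, f (g' (Sum.inl x)).toReal ∂Q : ℝ) : EReal)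
      else ⊤) = ((a : ℝ) : EReal) *
      (if Integrable (fun x => f (g x).toReal) (Q.restrict {x | g x ≠ 0}) then
      ((∫ x in {x | g x ≠ 0}, f (g x).toReal ∂Q : ℝ) : EReal) else ⊤) := by
    split_ifs
    · simp [hg']
    · rw [EReal.coe_mul_top_of_pos haR]
  rw [e1]
  have nn : ∀ x : ℝ≥0∞, (0 : EReal) ≤ x := fun x => EReal.coe_ennreal_nonneg x
  have aa : (((a : ℝ≥0∞)) : EReal) = ((a : ℝ) : EReal) := rfl
  have ee : (((e : ℝ≥0∞)) : EReal) = ((e : ℝ) : EReal) := rfl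
  have haE : (0 : EReal) ≤ ((a : ℝ) : EReal) := by exact_mod_cast haR.le
  have heE : (0 : EReal) ≤ ((e : ℝ) : EReal) := by exact_mod_cast e.2
  rw [EReal.coe_ennreal_add, EReal.coe_ennreal_add, EReal.coe_ennreal_mul, EReal.coe_ennreal_mul,
    aa, ee, EReal.left_distrib_of_nonneg (mul_nonneg haE (nn _)) heE,
    EReal.left_distrib_of_nonneg (mul_nonneg haE (nn _)) heE,
    EReal.left_distrib_of_nonneg_of_ne_top haE (EReal.coe_ne_top _),
    EReal.left_distrib_of_nonneg_of_ne_top haE (EReal.coe_ne_top _),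
    EReal.left_distrib_of_nonneg_of_ne_top heE (EReal.coe_ne_top _)]
  rw [mul_left_comm (limAtZero f), mul_left_comm (derivAtTop f), mul_comm (limAtZero f) (e : ℝ),
    mul_comm (derivAtTop f) (e : ℝ)]
  abel

/-- The mixed pair. -/
def mixPair (pp : PMPair) (a e : ℝ≥0) (hae : a + e = 1) : PMPair where
  carrier := pp.carrier ⊕ Bool
  inst := inferInstance
  P := mixP a e pp.P true
  Q := mixP a e pp.Q false
  probP := by have := pp.probP; exact mixP_prob hae _ _
  probQ := by have := pp.probQ; exact mixP_prob hae _ _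

lemma fDiv_mixPair (f : ℝ → ℝ) (hf : ConvexOn ℝ (Set.Ioi 0) f) (hf1 : f 1 = 0)
    (pp : PMPair) (a e : ℝ≥0) (ha : 0 < a) (hae : a + e = 1) :
    fDiv f (mixPair pp a e hae).P (mixPair pp a e hae).Q =
      ((a : ℝ) : EReal) * fDiv f pp.P pp.Q
        + ((e : ℝ) : EReal) * (limAtZero f + derivAtTop f) := by
  have := pp.probP
  have := pp.probQ
  exact fDiv_mix f hf hf1 pp.P pp.Q a e ha hae

/-- **Lemma 6.** If `D_f, D_{f_1}, …, D_{f_m}` are finite divergences and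
`D_{f_{m+1}}, …, D_{f_{m+l}}` are non-finite, then the constraints coming from the non-finite
divergences can be dropped: `B(D_1,…,D_{m+l}) = B(D_1,…,D_m)`. -/
theorem drop_nonfinite_constraints (m l : ℕ) (f : ℝ → ℝ) (fs : Fin (m + l) → ℝ → ℝ)
    (hf : ConvexOn ℝ (Set.Ioi 0) f) (hf1 : f 1 = 0)
    (hfs : ∀ i, ConvexOn ℝ (Set.Ioi 0) (fs i)) (hfs1 : ∀ i, fs i 1 = 0)
    (hffin : sSup {x : EReal | ∃ pp : PMPair, x = fDiv f pp.P pp.Q} < ⊤)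
    (hfin : ∀ i : Fin (m + l), (i : ℕ) < m →
      sSup {x : EReal | ∃ pp : PMPair, x = fDiv (fs i) pp.P pp.Q} < ⊤)
    (hinf : ∀ i : Fin (m + l), m ≤ (i : ℕ) →
      sSup {x : EReal | ∃ pp : PMPair, x = fDiv (fs i) pp.P pp.Q} = ⊤)
    (D : Fin (m + l) → ℝ) (hD : ∀ i, 0 ≤ D i) :
    sInf {x : EReal | ∃ pp : PMPair,
        (∀ i, (D i : EReal) ≤ fDiv (fs i) pp.P pp.Q) ∧ x = fDiv f pp.P pp.Q} =
    sInf {x : EReal | ∃ pp : PMPair,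
        (∀ i : Fin (m + l), (i : ℕ) < m → (D i : EReal) ≤ fDiv (fs i) pp.P pp.Q) ∧
        x = fDiv f pp.P pp.Q} := by
  have nb : ∀ (h : ℝ → ℝ), ConvexOn ℝ (Set.Ioi 0) h → h 1 = 0 → ∀ pp : PMPair,
      fDiv h pp.P pp.Q ≠ ⊥ := by
    intro h h1 h2 pp
    have := pp.probP
    have := pp.probQ
    exact fDiv_ne_bot h1 h2 _ _
  have ub : ∀ (h : ℝ → ℝ), ConvexOn ℝ (Set.Ioi 0) h → h 1 = 0 → ∀ pp : PMPair,
      fDiv h pp.P pp.Q ≤ limAtZero h + derivAtTop h := by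
    intro h h1 h2 pp
    have := pp.probP
    have := pp.probQ
    exact fDiv_le h1 h2 _ _
  apply le_antisymm
  swap
  · apply sInf_le_sInf
    rintro x ⟨pp, h, rfl⟩
    exact ⟨pp, fun i _ => h i, rfl⟩
  apply le_sInf
  rintro x ⟨pp, hpp, rfl⟩
  -- finiteness for `f`
  have dfin : ∀ pp : PMPair, fDiv f pp.P pp.Q ≠ ⊤ := fun pp =>
    (lt_of_le_of_lt (le_sSup (show fDiv f pp.P pp.Q ∈ {x : EReal | ∃ pp : PMPair, x = fDiv f pp.P pp.Q}
      from ⟨pp, rfl⟩)) hffin).ne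
  have Tb : limAtZero f + derivAtTop f ≠ ⊥ := fun h => nb f hf hf1 pp (by
    have := ub f hf hf1 pp
    rwa [h, le_bot_iff] at this)
  obtain ⟨d, hd⟩ : ∃ d : ℝ, fDiv f pp.P pp.Q = d :=
    ⟨_, (EReal.coe_toReal (dfin pp) (nb f hf hf1 pp)).symm⟩
  have half : (1/2 : ℝ≥0) + 1/2 = 1 := by norm_num
  have Tt : limAtZero f + derivAtTop f ≠ ⊤ := by
    intro h
    apply dfin (mixPair pp (1/2) (1/2) half)
    rw [fDiv_mixPair f hf hf1 pp _ _ (by norm_num) half, h, hd,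
      EReal.coe_mul_top_of_pos (by norm_num), ← EReal.coe_mul,
      EReal.add_top_of_ne_bot (EReal.coe_ne_bot _)]
  obtain ⟨T, hT⟩ : ∃ T : ℝ, limAtZero f + derivAtTop f = T :=
    ⟨_, (EReal.coe_toReal Tt Tb).symm⟩
  have key : ∀ ε : ℝ, 0 < ε → ε < 1 →
      sInf {x : EReal | ∃ pp : PMPair,
        (∀ i, (D i : EReal) ≤ fDiv (fs i) pp.P pp.Q) ∧ x = fDiv f pp.P pp.Q}
      ≤ (((1 - ε) * d + ε * T : ℝ) : EReal) := by
    intro ε h0 h1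
    obtain ⟨a, hav⟩ : ∃ a : ℝ≥0, (a : ℝ) = 1 - ε :=
      ⟨Real.toNNReal (1 - ε), Real.coe_toNNReal _ (by linarith)⟩
    obtain ⟨e, hev⟩ : ∃ e : ℝ≥0, (e : ℝ) = ε := ⟨Real.toNNReal ε, Real.coe_toNNReal _ h0.le⟩
    have hae : a + e = 1 := by
      apply NNReal.eq
      rw [NNReal.coe_add, hav, hev]
      simp
    have hapos : 0 < a := by
      rw [← NNReal.coe_pos, hav]
      linarith
    apply sInf_le
    refine ⟨mixPair pp _ _ hae, ?_, ?_⟩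
    · intro i
      rw [fDiv_mixPair (fs i) (hfs i) (hfs1 i) pp _ _ hapos hae, hav, hev]
      have hu := ub (fs i) (hfs i) (hfs1 i) pp
      have hnb := nb (fs i) (hfs i) (hfs1 i) pp
      have tops : limAtZero (fs i) + derivAtTop (fs i) = ⊤ →
          (D i : EReal) ≤ ((1 - ε : ℝ) : EReal) * fDiv (fs i) pp.P pp.Q
            + (ε : EReal) * (limAtZero (fs i) + derivAtTop (fs i)) := by
        intro h
        rw [h, EReal.coe_mul_top_of_pos h0, EReal.add_top_of_ne_bot]
        · exact le_top
        · generalize fDiv (fs i) pp.P pp.Q = y at hnb ⊢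
          induction y with
          | bot => exact absurd rfl hnb
          | coe r => rw [← EReal.coe_mul]; exact EReal.coe_ne_bot _
          | top => rw [EReal.coe_mul_top_of_pos (by linarith)]; simp
      by_cases him : (i : ℕ) < m
      · by_cases ht : limAtZero (fs i) + derivAtTop (fs i) = ⊤
        · exact tops ht
        · refine (hpp i him).trans ?_
          generalize limAtZero (fs i) + derivAtTop (fs i) = t at hu ht ⊢
          generalize fDiv (fs i) pp.P pp.Q = y at hnb hu ⊢
          have hyt : y ≠ ⊤ := fun h => ht (by rwa [h, top_le_iff] at hu)
          have htb : t ≠ ⊥ := fun h => hnb (by rwa [h, le_bot_iff] at hu)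
          lift y to ℝ using ⟨hyt, hnb⟩
          lift t to ℝ using ⟨ht, htb⟩
          norm_cast at hu ⊢
          nlinarith
      · apply tops
        rw [← top_le_iff, ← hinf i (not_lt.mp him)]
        apply sSup_le
        rintro x ⟨qq, rfl⟩
        exact ub (fs i) (hfs i) (hfs1 i) qq
    · rw [fDiv_mixPair f hf hf1 pp _ _ hapos hae, hav, hev, hd, hT]
      norm_cast
  rw [hd]
  have Tn : Filter.Tendsto (fun ε : ℝ => (((1 - ε) * d + ε * T : ℝ) : EReal))
      (nhdsWithin 0 (Set.Ioi 0)) (nhds (((1 - 0) * d + 0 * T : ℝ) : EReal)) := by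
    apply Filter.Tendsto.mono_left _ nhdsWithin_le_nhds
    apply (continuous_coe_real_ereal.tendsto _).comp
    apply ContinuousAt.tendsto (f := fun ε : ℝ => (1 - ε) * d + ε * T)
    fun_prop
  have := ge_of_tendsto Tn (by
    filter_upwards [Ioo_mem_nhdsGT (one_pos : (0:ℝ) < 1)] with ε hε
    exact key ε hε.1 hε.2)
  simpa using this


end
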